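/- For every positive integer ℓ and all reals b, c > 1, the Hausdorff dimension of E″_ℓ(φ_{b,c}) and the Hausdorff dimension of E′_ℓ(φ_{b,c}) are both equal to 1/(b+1). -/

import Mathlib

open MeasureTheory Filter Set

/-- The Gauss map `T(x) = 1/x - ⌊1/x⌋` (with `T 0 = 0`). -/
noncomputable def gaussMap (x : ℝ) : ℝ := if x = 0 then 0 else Int.fract x⁻¹

/-- `cfA x n` is the `n`-th partial quotient `a_n(x) = ⌊1 / T^{n-1}(x)⌋` (for `n ≥ 1`). -/
noncomputable def cfA (x : ℝ) (n : ℕ) : ℕ := ⌊(gaussMap^[n - 1] x)⁻¹⌋₊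

/-- `cfA' x n` is `a_n(x)` if it is prime, and `0` otherwise. -/
noncomputable def cfA' (x : ℝ) (n : ℕ) : ℕ := if (cfA x n).Prime then cfA x n else 0

/-- `Eprimeℓ ℓ φ` is the set `E′_ℓ(φ)` of irrational `x ∈ [0,1)` such that
`a′_n(x) ⋯ a′_{n+ℓ-1}(x) ≥ φ(n)` for infinitely many `n ∈ ℕ`. -/
noncomputable def Eprimeℓ (ℓ : ℕ) (φ : ℕ → ℝ) : Set ℝ :=
  {x | x ∈ Set.Ico (0 : ℝ) 1 ∧ Irrational x ∧
    {n : ℕ | 1 ≤ n ∧ φ n ≤ ∏ i ∈ Finset.range ℓ, (cfA' x (n + i) : ℝ)}.Infinite}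

/-- `Eprimeprimeℓ ℓ φ` is the set `E″_ℓ(φ)` of irrational `x ∈ [0,1)` such that
`a′_n(x) ⋯ a′_{n+ℓ-1}(x) ≥ φ(n)` for all `n ∈ ℕ`. -/
noncomputable def Eprimeprimeℓ (ℓ : ℕ) (φ : ℕ → ℝ) : Set ℝ :=
  {x | x ∈ Set.Ico (0 : ℝ) 1 ∧ Irrational x ∧
    ∀ n : ℕ, 1 ≤ n → φ n ≤ ∏ i ∈ Finset.range ℓ, (cfA' x (n + i) : ℝ)}

open scoped Topology ENNReal NNReal

/-- Every sequence of integers `≥ 2` is the sequence of partial quotients of a continued fraction,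
whose successive tails are the `x k`. -/
lemma exists_tails (a : ℕ → ℕ) (ha : ∀ k, 2 ≤ a k) :
    ∃ x : ℕ → ℝ, ∀ k, 0 < x k ∧ x k ≤ 1 / 2 ∧ (x k)⁻¹ = a k + x (k + 1) := by
  have ha' : ∀ k, (2 : ℝ) ≤ a k := fun k => by exact_mod_cast ha k
  have hpos : ∀ (k : ℕ) (y : ℝ), 0 < (a k : ℝ) + |y| := fun k y => by
    linarith [ha' k, abs_nonneg y]
  have hle : ∀ (k : ℕ) (y : ℝ), ((a k : ℝ) + |y|)⁻¹ ≤ 1 / 2 := fun k y => by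
    rw [one_div]
    exact inv_anti₀ (by norm_num) (by linarith [ha' k, abs_nonneg y])
  let Φ : BoundedContinuousFunction ℕ ℝ → BoundedContinuousFunction ℕ ℝ := fun u =>
    BoundedContinuousFunction.ofNormedAddCommGroupDiscrete
      (fun k => ((a k : ℝ) + |u (k + 1)|)⁻¹) (1 / 2) fun k => by
        rw [Real.norm_of_nonneg (inv_nonneg.2 (hpos _ _).le)]
        exact hle _ _
  have hΦ : ContractingWith (1 / 2) Φ := by
    refine ⟨by norm_num, LipschitzWith.of_dist_le_mul fun u v => ?_⟩
    refine (BoundedContinuousFunction.dist_le (by positivity)).2 fun k => ?_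
    have h1 : Φ u k - Φ v k =
        (|v (k + 1)| - |u (k + 1)|) * (Φ u k * Φ v k) := by
      have hu := (hpos k (u (k + 1))).ne'
      have hv := (hpos k (v (k + 1))).ne'
      change ((a k : ℝ) + |u (k + 1)|)⁻¹ - ((a k : ℝ) + |v (k + 1)|)⁻¹ =
        (|v (k + 1)| - |u (k + 1)|) * (((a k : ℝ) + |u (k + 1)|)⁻¹ * ((a k : ℝ) + |v (k + 1)|)⁻¹)
      field_simp
      ring
    have h2 : |Φ u k * Φ v k| ≤ 1 / 2 := by
      have hu : |Φ u k| ≤ 1 / 2 :=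
        (abs_of_nonneg (a := Φ u k) (inv_nonneg.2 (hpos _ _).le)).trans_le (hle _ _)
      have hv : |Φ v k| ≤ 1 / 2 :=
        (abs_of_nonneg (a := Φ v k) (inv_nonneg.2 (hpos _ _).le)).trans_le (hle _ _)
      rw [abs_mul]
      nlinarith [abs_nonneg (Φ u k), abs_nonneg (Φ v k)]
    have h3 : |(|v (k + 1)| - |u (k + 1)|)| ≤ dist u v := by
      refine (abs_abs_sub_abs_le_abs_sub _ _).trans ?_
      rw [abs_sub_comm, ← Real.dist_eq]
      exact BoundedContinuousFunction.dist_coe_le_dist _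
    rw [Real.dist_eq, h1, abs_mul, mul_comm]
    push_cast
    exact mul_le_mul h2 h3 (abs_nonneg _) (by norm_num)
  obtain ⟨u, hu⟩ : ∃ u, Φ u = u := ⟨_, hΦ.fixedPoint_isFixedPt⟩
  have hk : ∀ k, u k = ((a k : ℝ) + |u (k + 1)|)⁻¹ := fun k => by
    conv_lhs => rw [← hu]
    rfl
  have hu0 : ∀ k, 0 < u k := fun k => by rw [hk]; exact inv_pos.2 (hpos _ _)
  refine ⟨u, fun k => ⟨hu0 k, ?_, ?_⟩⟩
  · rw [hk]; exact hle _ _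
  · rw [hk k, inv_inv, abs_of_pos (hu0 _)]

lemma gaussMap_of_inv_eq {x y : ℝ} {m : ℕ} (hx : 0 < x) (hy0 : 0 ≤ y) (hy1 : y < 1)
    (h : x⁻¹ = m + y) : gaussMap x = y := by
  rw [gaussMap, if_neg hx.ne', h, Int.fract_natCast_add]
  exact Int.fract_eq_self.2 ⟨hy0, hy1⟩

lemma floor_inv_of_inv_eq {x y : ℝ} {m : ℕ} (hy0 : 0 ≤ y) (hy1 : y < 1)
    (h : x⁻¹ = m + y) : ⌊x⁻¹⌋₊ = m := by
  rw [h, add_comm, Nat.floor_add_natCast hy0, Nat.floor_eq_zero.2 hy1, zero_add]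

lemma iterate_gaussMap_tails {a : ℕ → ℕ} {x : ℕ → ℝ}
    (hx : ∀ k, 0 < x k ∧ x k ≤ 1 / 2 ∧ (x k)⁻¹ = a k + x (k + 1)) (n : ℕ) :
    gaussMap^[n] (x 0) = x n := by
  induction n with
  | zero => rfl
  | succ n ih =>
    rw [Function.iterate_succ_apply', ih]
    exact gaussMap_of_inv_eq (hx n).1 (hx _).1.le (by linarith [(hx (n + 1)).2.1]) (hx n).2.2

lemma cfA_tails {a : ℕ → ℕ} {x : ℕ → ℝ}
    (hx : ∀ k, 0 < x k ∧ x k ≤ 1 / 2 ∧ (x k)⁻¹ = a k + x (k + 1)) (n : ℕ) :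
    cfA (x 0) (n + 1) = a n := by
  rw [cfA, Nat.add_sub_cancel, iterate_gaussMap_tails hx]
  exact floor_inv_of_inv_eq (hx _).1.le (by linarith [(hx (n + 1)).2.1]) (hx n).2.2

/-- Points of the unit interval whose first `n` partial quotients agree are separated in terms of
their images under the `n`-th iterate of the Gauss map. -/
lemma le_dist_tails {a a' : ℕ → ℕ} {x y : ℕ → ℝ} {B : ℕ → ℝ}
    (hx : ∀ k, 0 < x k ∧ x k ≤ 1 / 2 ∧ (x k)⁻¹ = a k + x (k + 1))
    (hy : ∀ k, 0 < y k ∧ y k ≤ 1 / 2 ∧ (y k)⁻¹ = a' k + y (k + 1))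
    (hB : ∀ k, (a k : ℝ) + 1 ≤ B k) (hB' : ∀ k, (a' k : ℝ) + 1 ≤ B k)
    {n : ℕ} (h : ∀ k < n, a k = a' k) (hn : a n ≠ a' n) :
    |(a n : ℝ) - a' n| / 2 * ∏ k ∈ Finset.range (n + 1), (B k ^ 2)⁻¹ ≤ |x 0 - y 0| := by
  have hB0 : ∀ k, 0 < B k := fun k => by linarith [hB k, (a k).cast_nonneg (α := ℝ)]
  have hxB : ∀ k, (B k)⁻¹ ≤ x k := fun k => by
    rw [← inv_inv (x k), (hx k).2.2]
    refine inv_anti₀ ?_ (by linarith [hB k, (hx (k + 1)).2.1])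
    rw [← (hx k).2.2]; exact inv_pos.2 (hx k).1
  have hyB : ∀ k, (B k)⁻¹ ≤ y k := fun k => by
    rw [← inv_inv (y k), (hy k).2.2]
    refine inv_anti₀ ?_ (by linarith [hB' k, (hy (k + 1)).2.1])
    rw [← (hy k).2.2]; exact inv_pos.2 (hy k).1
  have hxy : ∀ k, |x k - y k| = |(y k)⁻¹ - (x k)⁻¹| * (x k * y k) := fun k => by
    have h1 := (hx k).1
    have h2 := (hy k).1
    rw [← abs_of_pos (mul_pos h1 h2), ← abs_mul]
    congr 1
    field_simp
  have hprod : ∀ k, (B k ^ 2)⁻¹ ≤ x k * y k := fun k => by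
    rw [sq, mul_inv]
    exact mul_le_mul (hxB k) (hyB k) (inv_pos.2 (hB0 k)).le (hx k).1.le
  have hlast : |(a n : ℝ) - a' n| / 2 * (B n ^ 2)⁻¹ ≤ |x n - y n| := by
    rw [hxy, (hx n).2.2, (hy n).2.2]
    refine mul_le_mul ?_ (hprod n) (by positivity) (abs_nonneg _)
    have h1 : (1 : ℝ) ≤ |(a n : ℝ) - a' n| := by
      have h0 : (1 : ℤ) ≤ |(a n : ℤ) - a' n| := Int.one_le_abs (sub_ne_zero.2 (by exact_mod_cast hn))
      exact_mod_cast h0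
    have h2 : |y (n + 1) - x (n + 1)| ≤ 1 / 2 := by
      rw [abs_le]
      constructor <;> linarith [hx (n + 1), hy (n + 1), (hx (n + 1)).2.1, (hy (n + 1)).2.1,
        (hx (n + 1)).1, (hy (n + 1)).1]
    have h3 := abs_sub_abs_le_abs_sub ((a' n : ℝ) - a n) (-(y (n + 1) - x (n + 1)))
    rw [abs_neg, abs_sub_comm (a' n : ℝ)] at h3
    have h4 : (a' n : ℝ) - a n - -(y (n + 1) - x (n + 1)) =
      a' n + y (n + 1) - (a n + x (n + 1)) := by ring
    rw [h4] at h3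
    linarith
  have hind : ∀ m ≤ n, |x m - y m| * ∏ k ∈ Finset.range m, (B k ^ 2)⁻¹ ≤ |x 0 - y 0| := by
    intro m
    induction m with
    | zero => simp
    | succ m ih =>
      intro hm
      refine le_trans ?_ (ih (by omega))
      rw [Finset.prod_range_succ, mul_comm (∏ k ∈ Finset.range m, (B k ^ 2)⁻¹), ← mul_assoc]
      refine mul_le_mul_of_nonneg_right ?_ (Finset.prod_nonneg fun k _ => by positivity)
      rw [hxy m, (hx m).2.2, (hy m).2.2, h m (by omega), add_sub_add_left_eq_sub,
        abs_sub_comm (y _)]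
      exact mul_le_mul_of_nonneg_left (hprod m) (abs_nonneg _)
  refine le_trans ?_ (hind n le_rfl)
  rw [Finset.prod_range_succ, mul_comm (∏ k ∈ Finset.range n, (B k ^ 2)⁻¹), ← mul_assoc]
  exact mul_le_mul_of_nonneg_right hlast (Finset.prod_nonneg fun k _ => by positivity)

lemma le_dimH_image_of_dist_le {G : ℝ → ℝ} {S : Set ℝ} {C r : ℝ} (hC : 0 ≤ C) (hr : 0 < r)
    (h : ∀ t ∈ S, ∀ t' ∈ S, |t - t'| ≤ C * |G t - G t'| ^ r) :
    ENNReal.ofReal r * dimH S ≤ dimH (G '' S) := by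
  have hinj : InjOn G S := fun t ht t' ht' heq => by
    have := h t ht t' ht'
    rw [heq, sub_self, abs_zero, Real.zero_rpow hr.ne', mul_zero] at this
    exact sub_eq_zero.1 (abs_nonpos_iff.1 this)
  have hH : HolderOnWith C.toNNReal r.toNNReal (Function.invFunOn G S) (G '' S) := by
    rintro _ ⟨t, ht, rfl⟩ _ ⟨t', ht', rfl⟩
    rw [hinj.leftInvOn_invFunOn ht, hinj.leftInvOn_invFunOn ht', edist_dist, edist_dist,
      Real.coe_toNNReal r hr.le, ENNReal.ofReal_rpow_of_nonneg dist_nonneg hr.le]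
    change _ ≤ ENNReal.ofReal C * _
    rw [← ENNReal.ofReal_mul hC]
    exact ENNReal.ofReal_le_ofReal (h t ht t' ht')
  have hdim := hH.dimH_image_le (Real.toNNReal_pos.2 hr)
  rw [image_image, image_congr fun t ht => hinj.leftInvOn_invFunOn ht, image_id'] at hdim
  have := mul_le_mul_right hdim (ENNReal.ofReal r)
  refine this.trans (le_of_eq ?_)
  exact ENNReal.mul_div_cancel (by simpa using hr) ENNReal.ofReal_ne_top

/-- Remainders in the Cantor series expansion of `t` with respect to the bases `M`. -/
noncomputable def cantorRem (M : ℕ → ℕ) (t : ℝ) : ℕ → ℝ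
  | 0 => t
  | k + 1 => Int.fract (M k * cantorRem M t k)

/-- Digits in the Cantor series expansion of `t` with respect to the bases `M`. -/
noncomputable def cantorDigit (M : ℕ → ℕ) (t : ℝ) (k : ℕ) : ℕ := ⌊M k * cantorRem M t k⌋₊

section Cantor

variable {M : ℕ → ℕ} {t t' : ℝ}

lemma cantorRem_mem (ht : t ∈ Ico (0 : ℝ) 1) (k : ℕ) : cantorRem M t k ∈ Ico (0 : ℝ) 1 := by
  cases k with
  | zero => exact ht
  | succ k => exact ⟨Int.fract_nonneg _, Int.fract_lt_one _⟩

lemma mul_cantorRem (ht : t ∈ Ico (0 : ℝ) 1) (k : ℕ) :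
    M k * cantorRem M t k = cantorDigit M t k + cantorRem M t (k + 1) := by
  have h0 : 0 ≤ M k * cantorRem M t k := mul_nonneg (Nat.cast_nonneg _) (cantorRem_mem ht k).1
  rw [cantorDigit, natCast_floor_eq_intCast_floor h0]
  exact (Int.floor_add_fract _).symm

lemma cantorDigit_lt (hM : ∀ k, 2 ≤ M k) (ht : t ∈ Ico (0 : ℝ) 1) (k : ℕ) :
    cantorDigit M t k < M k := by
  have hMk : (0 : ℝ) < M k := by exact_mod_cast (by linarith [hM k] : 0 < M k)
  have h0 : 0 ≤ M k * cantorRem M t k := mul_nonneg (Nat.cast_nonneg _) (cantorRem_mem ht k).1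
  exact (Nat.floor_lt h0).2 (by nlinarith [(cantorRem_mem (M := M) ht k).2])

lemma abs_sub_mul_prod_eq (ht : t ∈ Ico (0 : ℝ) 1) (ht' : t' ∈ Ico (0 : ℝ) 1) {n : ℕ}
    (h : ∀ k < n, cantorDigit M t k = cantorDigit M t' k) :
    |t - t'| * ∏ k ∈ Finset.range n, (M k : ℝ) = |cantorRem M t n - cantorRem M t' n| := by
  induction n with
  | zero => simp [cantorRem]
  | succ n ih =>
    rw [Finset.prod_range_succ, ← mul_assoc, ih fun k hk => h k (by omega),
      ← abs_of_nonneg (Nat.cast_nonneg (α := ℝ) (M n)), ← abs_mul]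
    congr 1
    have h1 := mul_cantorRem (M := M) ht n
    have h2 := mul_cantorRem (M := M) ht' n
    rw [h n (by omega)] at h1
    linarith

lemma exists_cantorDigit_ne (hM : ∀ k, 2 ≤ M k) (ht : t ∈ Ico (0 : ℝ) 1)
    (ht' : t' ∈ Ico (0 : ℝ) 1) (hne : t ≠ t') :
    ∃ n, (∀ k < n, cantorDigit M t k = cantorDigit M t' k) ∧
      cantorDigit M t n ≠ cantorDigit M t' n := by
  classical
  have hex : ∃ n, cantorDigit M t n ≠ cantorDigit M t' n := by
    by_contra! hall
    obtain ⟨n, hn⟩ := pow_unbounded_of_one_lt |t - t'|⁻¹ (one_lt_two : (1 : ℝ) < 2)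
    have hpos : 0 < |t - t'| := abs_pos.2 (sub_ne_zero.2 hne)
    have h1 := abs_sub_mul_prod_eq (M := M) ht ht' (n := n) fun k _ => hall k
    have h2 : |cantorRem M t n - cantorRem M t' n| ≤ 1 := by
      rw [abs_le]
      constructor <;> linarith [(cantorRem_mem (M := M) ht n).1, (cantorRem_mem (M := M) ht n).2,
        (cantorRem_mem (M := M) ht' n).1, (cantorRem_mem (M := M) ht' n).2]
    have h3 : (2 : ℝ) ^ n ≤ ∏ k ∈ Finset.range n, (M k : ℝ) := by
      have := Finset.prod_le_prod (s := Finset.range n) (f := fun _ => (2 : ℝ))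
        (g := fun k => (M k : ℝ)) (fun _ _ => by norm_num) fun k _ => by exact_mod_cast hM k
      simpa using this
    have h4 : 1 < |t - t'| * 2 ^ n := by
      rwa [inv_lt_iff_one_lt_mul₀' hpos] at hn
    nlinarith
  exact ⟨Nat.find hex, fun k hk => not_not.1 (Nat.find_min hex hk), Nat.find_spec hex⟩

lemma abs_sub_mul_prod_le (ht : t ∈ Ico (0 : ℝ) 1) (ht' : t' ∈ Ico (0 : ℝ) 1) {n : ℕ}
    (h : ∀ k < n, cantorDigit M t k = cantorDigit M t' k)
    (hn : cantorDigit M t n ≠ cantorDigit M t' n) :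
    |t - t'| * ∏ k ∈ Finset.range (n + 1), (M k : ℝ) ≤
      2 * |(cantorDigit M t n : ℝ) - cantorDigit M t' n| := by
  rw [Finset.prod_range_succ, ← mul_assoc, abs_sub_mul_prod_eq ht ht' h]
  have h0 : (1 : ℝ) ≤ |(cantorDigit M t n : ℝ) - cantorDigit M t' n| := by
    have h0 : (1 : ℤ) ≤ |(cantorDigit M t n : ℤ) - cantorDigit M t' n| :=
      Int.one_le_abs (sub_ne_zero.2 (by exact_mod_cast hn))
    exact_mod_cast h0
  have h2 : |cantorRem M t (n + 1) - cantorRem M t' (n + 1)| ≤ 1 := by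
    rw [abs_le]
    constructor <;> linarith [(cantorRem_mem (M := M) ht (n + 1)).1,
      (cantorRem_mem (M := M) ht (n + 1)).2, (cantorRem_mem (M := M) ht' (n + 1)).1,
      (cantorRem_mem (M := M) ht' (n + 1)).2]
  have h3 : |cantorRem M t n - cantorRem M t' n| * M n =
      |((cantorDigit M t n : ℝ) - cantorDigit M t' n) +
        (cantorRem M t (n + 1) - cantorRem M t' (n + 1))| := by
    rw [← abs_of_nonneg (Nat.cast_nonneg (α := ℝ) (M n)), ← abs_mul]
    congr 1
    linarith [mul_cantorRem (M := M) ht n, mul_cantorRem (M := M) ht' n]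
  rw [h3]
  linarith [abs_add_le ((cantorDigit M t n : ℝ) - cantorDigit M t' n)
    (cantorRem M t (n + 1) - cantorRem M t' (n + 1))]

end Cantor

lemma abs_sub_le_abs_nth_prime_sub (i j : ℕ) :
    |(i : ℝ) - j| ≤ |(Nat.nth Nat.Prime i : ℝ) - Nat.nth Nat.Prime j| := by
  wlog hij : j ≤ i generalizing i j
  · rw [abs_sub_comm, abs_sub_comm (Nat.nth Nat.Prime i : ℝ)]
    exact this j i (by omega)
  have hadd : ∀ d, Nat.nth Nat.Prime j + d ≤ Nat.nth Nat.Prime (j + d) := fun d => by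
    induction d with
    | zero => simp
    | succ d ih =>
      have := Nat.nth_strictMono Nat.infinite_setOfPred_prime (Nat.lt_succ_self (j + d))
      rw [← add_assoc]
      exact (Nat.succ_le_succ ih).trans this
  obtain ⟨d, rfl⟩ := Nat.exists_eq_add_of_le hij
  have h1 : (Nat.nth Nat.Prime j : ℝ) + d ≤ Nat.nth Nat.Prime (j + d) := by exact_mod_cast hadd d
  have h2 : (0 : ℝ) ≤ d := Nat.cast_nonneg d
  push_cast
  rw [abs_of_nonneg (by linarith), abs_of_nonneg (by linarith)]
  linarith

/-- Points all of whose partial quotients are primes bounded below by a sequence `M`. -/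
lemma le_dimH_prime_digits {M : ℕ → ℕ} {B : ℕ → ℝ} {K r : ℝ} (hM : ∀ k, 2 ≤ M k) (hK : 0 ≤ K)
    (hr : 0 < r) (hr1 : r ≤ 1)
    (hB : ∀ k, ∀ i < 2 * M k, (Nat.nth Nat.Prime i : ℝ) + 1 ≤ B k)
    (h : ∀ n, (M n : ℝ) ^ (1 - r) * (∏ k ∈ Finset.range (n + 1), B k ^ 2) ^ r ≤
      K * ∏ k ∈ Finset.range (n + 1), (M k : ℝ)) :
    ENNReal.ofReal r ≤ dimH {x | x ∈ Ico (0 : ℝ) 1 ∧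
      ∀ n, (cfA x (n + 1)).Prime ∧ M n ≤ cfA x (n + 1)} := by
  have hprime : ∀ i, (Nat.nth Nat.Prime i).Prime := Nat.prime_nth_prime
  choose X hX using fun t : ℝ => exists_tails
    (fun k => Nat.nth Nat.Prime (M k + cantorDigit M t k)) fun k => (hprime _).two_le
  have hsub : (fun t => X t 0) '' Ico (0 : ℝ) 1 ⊆ {x | x ∈ Ico (0 : ℝ) 1 ∧
      ∀ n, (cfA x (n + 1)).Prime ∧ M n ≤ cfA x (n + 1)} := by
    rintro _ ⟨t, ht, rfl⟩
    refine ⟨⟨(hX t 0).1.le, by linarith [(hX t 0).2.1]⟩, fun n => ?_⟩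
    rw [cfA_tails (hX t) n]
    exact ⟨hprime _, (Nat.le_add_right _ _).trans
      (Nat.nth_strictMono Nat.infinite_setOfPred_prime).le_apply⟩
  refine le_trans ?_ (dimH_mono hsub)
  have hdim : dimH (Ico (0 : ℝ) 1) = 1 := by
    have := Real.dimH_of_nonempty_interior (s := Ico (0 : ℝ) 1) (by simp)
    simpa using this
  have key := le_dimH_image_of_dist_le (G := fun t => X t 0) (S := Ico (0 : ℝ) 1) (C := 4 * K)
    (r := r) (by positivity) hr ?_
  · rwa [hdim, mul_one] at key
  intro t ht t' ht'
  rcases eq_or_ne t t' with rfl | hne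
  · simp only [sub_self, abs_zero]
    positivity
  obtain ⟨n, hlt, hn⟩ := exists_cantorDigit_ne hM ht ht' hne
  have hle := abs_sub_mul_prod_le ht ht' hlt hn
  have hBt : ∀ t ∈ Ico (0 : ℝ) 1, ∀ k,
      (Nat.nth Nat.Prime (M k + cantorDigit M t k) : ℝ) + 1 ≤ B k := fun t ht k =>
    hB k _ (by linarith [cantorDigit_lt hM ht k])
  have hge := le_dist_tails (hX t) (hX t') (hBt t ht) (hBt t' ht') (n := n)
    (fun k hk => by simp only [hlt k hk])
    (fun heq => hn (by
      have := (Nat.nth_strictMono Nat.infinite_setOfPred_prime).injective heq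
      omega))
  have hgap := abs_sub_le_abs_nth_prime_sub (M n + cantorDigit M t n) (M n + cantorDigit M t' n)
  push_cast at hgap
  rw [add_sub_add_left_eq_sub] at hgap
  set δ := |(cantorDigit M t n : ℝ) - cantorDigit M t' n| with hδ
  have hδ0 : 0 < δ := abs_pos.2 (sub_ne_zero.2 (by exact_mod_cast hn))
  have hδM : δ ≤ M n := by
    have h1 : (cantorDigit M t n : ℝ) < M n := by exact_mod_cast cantorDigit_lt hM ht n
    have h2 : (cantorDigit M t' n : ℝ) < M n := by exact_mod_cast cantorDigit_lt hM ht' n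
    rw [hδ, abs_le]
    constructor <;> linarith [(cantorDigit M t n).cast_nonneg (α := ℝ),
      (cantorDigit M t' n).cast_nonneg (α := ℝ)]
  rw [Finset.prod_inv_distrib] at hge
  have hB0 : ∀ k, 0 < B k := fun k => by
    have := hBt t ht k
    linarith [(Nat.nth Nat.Prime (M k + cantorDigit M t k)).cast_nonneg (α := ℝ)]
  have hPB : 0 < ∏ k ∈ Finset.range (n + 1), B k ^ 2 :=
    Finset.prod_pos fun k _ => pow_pos (hB0 k) 2
  have hPM : 0 < ∏ k ∈ Finset.range (n + 1), (M k : ℝ) :=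
    Finset.prod_pos fun k _ => by exact_mod_cast (by linarith [hM k] : 0 < M k)
  have hn' := h n
  set P := ∏ k ∈ Finset.range (n + 1), B k ^ 2
  set Q := ∏ k ∈ Finset.range (n + 1), (M k : ℝ)
  set D := |X t 0 - X t' 0|
  have hD : δ / P ≤ 2 * D := by
    rw [div_eq_mul_inv]
    have := mul_le_mul_of_nonneg_right hgap (inv_pos.2 hPB).le
    linarith
  have hPr : 0 < P ^ r := Real.rpow_pos_of_pos hPB r
  have h1 : δ * P ^ r ≤ δ ^ r * (K * Q) := by
    calc δ * P ^ r = δ ^ r * (δ ^ (1 - r) * P ^ r) := by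
          rw [← mul_assoc, ← Real.rpow_add hδ0, add_sub_cancel, Real.rpow_one]
      _ ≤ δ ^ r * ((M n : ℝ) ^ (1 - r) * P ^ r) := by
          have := Real.rpow_le_rpow hδ0.le hδM (by linarith : 0 ≤ 1 - r)
          gcongr
      _ ≤ _ := by gcongr
  have h2 : (δ / P) ^ r ≤ 2 * D ^ r := by
    calc (δ / P) ^ r ≤ (2 * D) ^ r := Real.rpow_le_rpow (by positivity) hD hr.le
      _ = 2 ^ r * D ^ r := Real.mul_rpow (by norm_num) (abs_nonneg _)
      _ ≤ 2 * D ^ r := by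
          have : (2 : ℝ) ^ r ≤ 2 ^ (1 : ℝ) := Real.rpow_le_rpow_of_exponent_le (by norm_num) hr1
          rw [Real.rpow_one] at this
          have h0 : 0 ≤ D ^ r := Real.rpow_nonneg (abs_nonneg _) r
          gcongr
  rw [Real.div_rpow hδ0.le hPB.le, div_le_iff₀ hPr] at h2
  have h3 : |t - t'| * Q * P ^ r ≤ 4 * K * D ^ r * Q * P ^ r := by
    calc |t - t'| * Q * P ^ r ≤ 2 * δ * P ^ r := by gcongr
      _ = 2 * (δ * P ^ r) := by ring
      _ ≤ 2 * (δ ^ r * (K * Q)) := by gcongr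
      _ ≤ 2 * (2 * D ^ r * P ^ r * (K * Q)) := by gcongr
      _ = _ := by ring
  exact le_of_mul_le_mul_right (le_of_mul_le_mul_right h3 hPr) hPM

/-- A weak form of Chebyshev's upper bound for the `i`-th prime. -/
lemma exists_nth_prime_le {η : ℝ} (hη : 0 < η) : ∃ L₀ : ℝ, 1 ≤ L₀ ∧ ∀ L ≥ L₀, ∀ i : ℕ,
    (i : ℝ) + 1 ≤ 4 * L → (Nat.nth Nat.Prime i : ℝ) + 1 ≤ L ^ (1 + η) := by
  have hθ : (1 + η)⁻¹ < 1 := inv_lt_one_of_one_lt₀ (by linarith)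
  have hθ0 : 0 < (1 + η)⁻¹ := by positivity
  have hev : ∀ᶠ x : ℝ in atTop,
      4 * x ^ (1 + η)⁻¹ * Real.log x + Real.log x + Real.log 2 < x * Real.log 2 := by
    have hl2 : 0 < Real.log 2 := Real.log_pos one_lt_two
    have h1 := (isLittleO_log_rpow_atTop (sub_pos.2 hθ)).bound
      (show 0 < Real.log 2 / 16 by positivity)
    have h2 := Real.isLittleO_log_id_atTop.bound (show 0 < Real.log 2 / 4 by positivity)
    filter_upwards [h1, h2, eventually_ge_atTop 4] with x hx1 hx2 hx
    have hlx : 0 ≤ Real.log x := Real.log_nonneg (by linarith)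
    have hx0 : 0 < x := by linarith
    rw [Real.norm_of_nonneg hlx, Real.norm_of_nonneg (by positivity)] at hx1 hx2
    simp only [id] at hx2
    have h3 : x ^ (1 + η)⁻¹ * Real.log x ≤ Real.log 2 / 16 * x := by
      calc x ^ (1 + η)⁻¹ * Real.log x
          ≤ x ^ (1 + η)⁻¹ * (Real.log 2 / 16 * x ^ (1 - (1 + η)⁻¹)) := by gcongr
        _ = Real.log 2 / 16 * (x ^ (1 + η)⁻¹ * x ^ (1 - (1 + η)⁻¹)) := by ring
        _ = _ := by rw [← Real.rpow_add hx0, add_sub_cancel, Real.rpow_one]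
    nlinarith
  obtain ⟨x₀, hx₀⟩ := eventually_atTop.1 hev
  refine ⟨max 1 x₀, le_max_left _ _, fun L hL i hi => ?_⟩
  have hL1 : 1 ≤ L := (le_max_left _ _).trans hL
  have hp2 := (Nat.prime_nth_prime i).two_le
  have hpi : Nat.primeCounting (Nat.nth Nat.Prime i) = i + 1 := by
    rw [Nat.primeCounting, Nat.primeCounting', Nat.count_succ,
      if_pos (Nat.prime_nth_prime i)]
    exact congrArg (· + 1) (Nat.primeCounting'_nth_eq i)
  set p := Nat.nth Nat.Prime i
  have hp2' : (2 : ℝ) ≤ p := by exact_mod_cast hp2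
  rcases lt_or_ge ((p : ℝ) + 1) x₀ with hlt | hge
  · calc (p : ℝ) + 1 ≤ L := hlt.le.trans ((le_max_right _ _).trans hL)
      _ = L ^ (1 : ℝ) := (Real.rpow_one L).symm
      _ ≤ L ^ (1 + η) := Real.rpow_le_rpow_of_exponent_le hL1 (by linarith)
  · have hlog : 0 < Real.log p := Real.log_pos (by linarith)
    have hlog' : Real.log p ≤ Real.log (p + 1) := Real.log_le_log (by linarith) (by linarith)
    have h1 := hx₀ _ hge
    have h2 := Chebyshev.pi_ge p
    rw [hpi, div_le_iff₀ hlog] at h2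
    push_cast at h2
    have h3 : 4 * ((p : ℝ) + 1) ^ (1 + η)⁻¹ * Real.log p ≤ 4 * L * Real.log p := by
      calc 4 * ((p : ℝ) + 1) ^ (1 + η)⁻¹ * Real.log p
          ≤ 4 * ((p : ℝ) + 1) ^ (1 + η)⁻¹ * Real.log (p + 1) := by gcongr
        _ ≤ p * Real.log 2 - Real.log (p + 1) := by linarith
        _ ≤ (i + 1) * Real.log p := h2
        _ ≤ _ := by gcongr
    have h4 := le_of_mul_le_mul_right h3 hlog
    have h5 : ((p : ℝ) + 1) ^ (1 + η)⁻¹ ≤ L := by linarith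
    calc (p : ℝ) + 1 = (((p : ℝ) + 1) ^ (1 + η)⁻¹) ^ (1 + η) := by
          rw [← Real.rpow_mul (by linarith), inv_mul_cancel₀ (by linarith), Real.rpow_one]
      _ ≤ L ^ (1 + η) := Real.rpow_le_rpow (by positivity) h5 (by linarith)

lemma dimH_inter_irrational (s : Set ℝ) : dimH (s ∩ {x | Irrational x}) = dimH s := by
  refine le_antisymm (dimH_mono inter_subset_left) ?_
  have hsub : s ⊆ (s ∩ {x | Irrational x}) ∪ range ((↑) : ℚ → ℝ) := fun x hx => by
    by_cases h : Irrational x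
    · exact Or.inl ⟨hx, h⟩
    · exact Or.inr (not_not.1 h)
  refine (dimH_mono hsub).trans ?_
  rw [dimH_union, dimH_countable (countable_range _), max_eq_left zero_le]

lemma exists_le_dimH_prime_digits {b c r : ℝ} (hb : 1 < b) (hr : 0 < r) (hrb : r < 1 / (b + 1)) :
    ∃ C ≥ c, 1 < C ∧ ENNReal.ofReal r ≤ dimH {x | x ∈ Ico (0 : ℝ) 1 ∧
      ∀ n, (cfA x (n + 1)).Prime ∧ ⌈C ^ b ^ (n + 1)⌉₊ ≤ cfA x (n + 1)} := by
  have hb0 : 0 < b := by linarith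
  have hrb' : r * (b + 1) < 1 := (lt_div_iff₀ (by linarith)).1 hrb
  have hr1 : r < 1 := by nlinarith
  set κ := (1 - r) * (b - 1) / b + 2 * r with hκ
  have hκ0 : 0 < κ := by
    have : 0 ≤ (1 - r) * (b - 1) / b :=
      div_nonneg (mul_nonneg (by linarith) (by linarith)) hb0.le
    linarith
  have hκ1 : κ < 1 := by
    have : κ = (b - 1 + r * (b + 1)) / b := by rw [hκ]; field_simp; ring
    rw [this, div_lt_one hb0]
    linarith
  obtain ⟨L₀, hL₀, hL⟩ := exists_nth_prime_le (η := κ⁻¹ - 1)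
    (sub_pos.2 ((one_lt_inv₀ hκ0).2 hκ1))
  rw [add_sub_cancel] at hL
  set C := max c (max L₀ 2)
  have hC2 : 2 ≤ C := (le_max_right _ _).trans (le_max_right _ _)
  have hCL : L₀ ≤ C := (le_max_left _ _).trans (le_max_right _ _)
  have hC0 : 0 < C := by linarith
  have hCk : ∀ k : ℕ, C ≤ C ^ b ^ (k + 1) := fun k => by
    calc C = C ^ (1 : ℝ) := (Real.rpow_one C).symm
      _ ≤ _ := Real.rpow_le_rpow_of_exponent_le (by linarith) (one_le_pow₀ hb.le)
  have hM : ∀ k : ℕ, (⌈C ^ b ^ (k + 1)⌉₊ : ℝ) ≤ 2 * C ^ b ^ (k + 1) := fun k => by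
    have := Nat.ceil_lt_add_one (a := C ^ b ^ (k + 1)) (by positivity)
    linarith [hCk k]
  refine ⟨C, le_max_left _ _, by linarith, le_dimH_prime_digits
    (B := fun k => (C ^ b ^ (k + 1)) ^ κ⁻¹) (K := 2 * C) (fun k => ?_) (by linarith) hr hr1.le
    (fun k i hi => hL _ (hCL.trans (hCk k)) i ?_) fun n => ?_⟩
  · have : (2 : ℝ) ≤ ⌈C ^ b ^ (k + 1)⌉₊ := (hC2.trans (hCk k)).trans (Nat.le_ceil _)
    exact_mod_cast this
  · have : (i : ℝ) + 1 ≤ 2 * ⌈C ^ b ^ (k + 1)⌉₊ := by exact_mod_cast hi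
    linarith [hM k]
  · set S := ∑ k ∈ Finset.range (n + 1), b ^ (k + 1) with hS
    have hSn : b ^ (n + 1) = (b - 1) / b * S + 1 := by
      have hgeom := mul_geom_sum b (n + 1)
      have : S = b * ∑ k ∈ Finset.range (n + 1), b ^ k := by
        rw [hS, Finset.mul_sum]
        exact Finset.sum_congr rfl fun k _ => pow_succ' b k
      rw [this]
      field_simp
      linarith
    have hprodB : ∏ k ∈ Finset.range (n + 1), ((C ^ b ^ (k + 1)) ^ κ⁻¹) ^ 2 =
        C ^ (2 * κ⁻¹ * S) := by
      rw [hS, Finset.mul_sum, Real.rpow_sum_of_pos hC0]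
      refine Finset.prod_congr rfl fun k _ => ?_
      rw [← Real.rpow_mul hC0.le, ← Real.rpow_natCast, ← Real.rpow_mul hC0.le]
      congr 1
      push_cast
      ring
    have hprodM : C ^ S ≤ ∏ k ∈ Finset.range (n + 1), (⌈C ^ b ^ (k + 1)⌉₊ : ℝ) := by
      rw [hS, Real.rpow_sum_of_pos hC0]
      exact Finset.prod_le_prod (fun k _ => by positivity) fun k _ => Nat.le_ceil _
    have hS0 : 0 ≤ S := Finset.sum_nonneg fun k _ => by positivity
    have hexp : b ^ (n + 1) * (1 - r) + 2 * κ⁻¹ * S * r ≤ 1 + S := by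
      have h1 : (1 - r) * ((b - 1) / b) ≤ κ⁻¹ * ((1 - r) * ((b - 1) / b)) := by
        refine le_mul_of_one_le_left ?_ ((one_lt_inv₀ hκ0).2 hκ1).le
        exact mul_nonneg (by linarith) (div_nonneg (by linarith) hb0.le)
      have h2 : κ⁻¹ * ((1 - r) * ((b - 1) / b)) + 2 * κ⁻¹ * r = 1 := by
        have : κ⁻¹ * κ = 1 := inv_mul_cancel₀ hκ0.ne'
        have h3 : (1 - r) * ((b - 1) / b) + 2 * r = κ := by rw [hκ, mul_div_assoc]
        linear_combination κ⁻¹ * h3 + this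
      rw [hSn]
      nlinarith
    calc (⌈C ^ b ^ (n + 1)⌉₊ : ℝ) ^ (1 - r) *
          (∏ k ∈ Finset.range (n + 1), ((C ^ b ^ (k + 1)) ^ κ⁻¹) ^ 2) ^ r
        ≤ (2 * C ^ b ^ (n + 1)) ^ (1 - r) * (C ^ (2 * κ⁻¹ * S)) ^ r := by
          rw [hprodB]
          gcongr
          exact hM n
      _ = 2 ^ (1 - r) * C ^ (b ^ (n + 1) * (1 - r) + 2 * κ⁻¹ * S * r) := by
          rw [Real.mul_rpow (by norm_num) (by positivity), ← Real.rpow_mul hC0.le,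
            ← Real.rpow_mul hC0.le, mul_assoc, ← Real.rpow_add hC0]
      _ ≤ 2 ^ (1 : ℝ) * C ^ (1 + S) := by
          gcongr <;> linarith
      _ = 2 * C * C ^ S := by
          rw [Real.rpow_one, Real.rpow_add hC0, Real.rpow_one, mul_assoc]
      _ ≤ _ := by gcongr

lemma le_dimH_Eprimeprimeℓ (ℓ : ℕ) (hℓ : 1 ≤ ℓ) {b c : ℝ} (hb : 1 < b) (hc : 1 < c) :
    ENNReal.ofReal (1 / (b + 1)) ≤ dimH (Eprimeprimeℓ ℓ (fun n => c ^ (b ^ n))) := by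
  have key : ∀ r, 0 < r → r < 1 / (b + 1) →
      ENNReal.ofReal r ≤ dimH (Eprimeprimeℓ ℓ (fun n => c ^ (b ^ n))) := by
    intro r hr hrb
    obtain ⟨C, hCc, hC1, hC⟩ := exists_le_dimH_prime_digits (c := c) hb hr hrb
    rw [← dimH_inter_irrational] at hC
    refine hC.trans (dimH_mono ?_)
    rintro x ⟨⟨hx, hdig⟩, hirr⟩
    refine ⟨hx, hirr, fun n hn => ?_⟩
    have hcf : ∀ m, 1 ≤ m → C ^ b ^ m ≤ (cfA' x m : ℝ) ∧ (1 : ℝ) ≤ cfA' x m := by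
      intro m hm
      obtain ⟨k, rfl⟩ := Nat.exists_eq_add_of_le' hm
      rw [cfA', if_pos (hdig k).1]
      exact ⟨Nat.ceil_le.1 (hdig k).2, by exact_mod_cast (hdig k).1.one_le⟩
    obtain ⟨l, rfl⟩ := Nat.exists_eq_add_of_le' hℓ
    rw [Finset.prod_range_succ']
    have h1 : (1 : ℝ) ≤ ∏ k ∈ Finset.range l, (cfA' x (n + (k + 1)) : ℝ) := by
      refine Finset.prod_induction _ (fun y => (1 : ℝ) ≤ y) (fun a b ha hb => ?_) le_rfl
        fun k _ => (hcf _ (by omega)).2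
      exact one_le_mul_of_one_le_of_one_le ha hb
    calc c ^ b ^ n ≤ C ^ b ^ n := Real.rpow_le_rpow (by linarith) hCc (by positivity)
      _ ≤ cfA' x (n + 0) := (hcf n hn).1
      _ ≤ _ := le_mul_of_one_le_left (Nat.cast_nonneg _) h1
  refine le_of_forall_lt_imp_le_of_dense fun a ha => ?_
  have hatop : a ≠ ⊤ := ha.ne_top
  rcases eq_or_ne a 0 with rfl | ha0
  · exact zero_le
  rw [← ENNReal.ofReal_toReal hatop]
  refine key _ (ENNReal.toReal_pos ha0 hatop) ?_
  exact (ENNReal.lt_ofReal_iff_toReal_lt hatop).1 ha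

lemma dimH_le_of_covers {s : ℝ≥0} (hs : 0 < s) {E : Set ℝ} {β : ℕ → Type} [∀ N, Countable (β N)]
    (U : ∀ N, β N → Set ℝ) {F : ℕ → ℝ≥0∞} (hF : Tendsto F atTop (𝓝 0))
    (hU : ∀ N, ∑' i, Metric.ediam (U N i) ^ (s : ℝ) ≤ F N) (hE : ∀ N, E ⊆ ⋃ i, U N i) :
    dimH E ≤ s := by
  have hs' : (0 : ℝ) < s := hs
  refine dimH_le_of_hausdorffMeasure_ne_top (ne_top_of_le_ne_top ENNReal.zero_ne_top ?_)
  have hr : Tendsto (fun N => F N ^ (s : ℝ)⁻¹) atTop (𝓝 0) := by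
    have := (ENNReal.continuous_rpow_const (y := (s : ℝ)⁻¹)).continuousAt.tendsto.comp hF
    rwa [ENNReal.zero_rpow_of_pos (inv_pos.2 hs')] at this
  refine (Measure.hausdorffMeasure_le_liminf_tsum (s : ℝ) E _ hr U
    (Eventually.of_forall fun N i => ?_) (Eventually.of_forall hE)).trans ?_
  · rw [ENNReal.le_rpow_inv_iff hs']
    exact (ENNReal.le_tsum i).trans (hU N)
  · calc liminf (fun N => ∑' i, Metric.ediam (U N i) ^ (s : ℝ)) atTop
        ≤ liminf F atTop := liminf_le_liminf (Eventually.of_forall hU)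
      _ = 0 := hF.liminf_eq

section Irrational

variable {x y : ℝ}

lemma gaussMap_spec (hx : x ∈ Ioo (0 : ℝ) 1) (hirr : Irrational x) :
    gaussMap x ∈ Ioo (0 : ℝ) 1 ∧ Irrational (gaussMap x) ∧
      x⁻¹ = ⌊x⁻¹⌋₊ + gaussMap x ∧ 1 ≤ ⌊x⁻¹⌋₊ := by
  have hg : gaussMap x = Int.fract x⁻¹ := by rw [gaussMap, if_neg hx.1.ne']
  have h0 : 0 ≤ x⁻¹ := inv_nonneg.2 hx.1.le
  have hirr' : Irrational (gaussMap x) := by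
    rw [hg, Int.fract]
    exact (irrational_inv_iff.2 hirr).sub_intCast _
  refine ⟨⟨lt_of_le_of_ne (by rw [hg]; exact Int.fract_nonneg _) hirr'.ne_zero.symm,
    by rw [hg]; exact Int.fract_lt_one _⟩, hirr', ?_, ?_⟩
  · rw [hg, natCast_floor_eq_intCast_floor h0]
    exact (Int.floor_add_fract _).symm
  · rw [Nat.one_le_floor_iff]
    exact (one_le_inv₀ hx.1).2 hx.2.le

lemma iterate_gaussMap_mem (hx : x ∈ Ico (0 : ℝ) 1) (hirr : Irrational x) (k : ℕ) :
    gaussMap^[k] x ∈ Ioo (0 : ℝ) 1 ∧ Irrational (gaussMap^[k] x) := by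
  induction k with
  | zero => exact ⟨⟨lt_of_le_of_ne hx.1 hirr.ne_zero.symm, hx.2⟩, hirr⟩
  | succ k ih =>
    rw [Function.iterate_succ_apply']
    exact ⟨(gaussMap_spec ih.1 ih.2).1, (gaussMap_spec ih.1 ih.2).2.1⟩

lemma inv_iterate_gaussMap (hx : x ∈ Ico (0 : ℝ) 1) (hirr : Irrational x) (k : ℕ) :
    (gaussMap^[k] x)⁻¹ = cfA x (k + 1) + gaussMap^[k + 1] x ∧ 1 ≤ cfA x (k + 1) := by
  obtain ⟨h1, h2⟩ := iterate_gaussMap_mem hx hirr k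
  rw [Function.iterate_succ_apply']
  exact (gaussMap_spec h1 h2).2.2

lemma iterate_gaussMap_le (hx : x ∈ Ico (0 : ℝ) 1) (hirr : Irrational x) (k : ℕ) :
    gaussMap^[k] x ≤ (cfA x (k + 1) : ℝ)⁻¹ := by
  obtain ⟨h1, h2⟩ := inv_iterate_gaussMap hx hirr k
  rw [← inv_inv (gaussMap^[k] x), h1]
  refine inv_anti₀ (by exact_mod_cast h2) ?_
  linarith [(iterate_gaussMap_mem hx hirr (k + 1)).1.1]

lemma abs_sub_le_of_cfA_eq (hx : x ∈ Ico (0 : ℝ) 1) (hxi : Irrational x)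
    (hy : y ∈ Ico (0 : ℝ) 1) (hyi : Irrational y) {n : ℕ}
    (h : ∀ k < n, cfA x (k + 1) = cfA y (k + 1)) :
    |x - y| ≤ |gaussMap^[n] x - gaussMap^[n] y| *
      ∏ k ∈ Finset.range n, ((cfA y (k + 1) : ℝ) ^ 2)⁻¹ := by
  induction n with
  | zero => simp
  | succ n ih =>
    refine (ih fun k hk => h k (by omega)).trans ?_
    rw [Finset.prod_range_succ, mul_comm (∏ k ∈ Finset.range n, _), ← mul_assoc]
    refine mul_le_mul_of_nonneg_right ?_ (Finset.prod_nonneg fun k _ => by positivity)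
    obtain ⟨⟨hx0, -⟩, -⟩ := iterate_gaussMap_mem hx hxi n
    obtain ⟨⟨hy0, -⟩, -⟩ := iterate_gaussMap_mem hy hyi n
    have hxle := iterate_gaussMap_le hx hxi n
    have hyle := iterate_gaussMap_le hy hyi n
    have hxe := (inv_iterate_gaussMap hx hxi n).1
    have hye := (inv_iterate_gaussMap hy hyi n).1
    rw [h n (by omega)] at hxle hxe
    have heq : gaussMap^[n] x - gaussMap^[n] y =
        ((gaussMap^[n] y)⁻¹ - (gaussMap^[n] x)⁻¹) * (gaussMap^[n] x * gaussMap^[n] y) := by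
      field_simp
    rw [heq, hxe, hye, add_sub_add_left_eq_sub, abs_mul, abs_of_pos (mul_pos hx0 hy0),
      abs_sub_comm, sq, mul_inv]
    gcongr

end Irrational

/-- Irrational points whose first `n` partial quotients are `w`, and whose next one is at least
`2 ^ j`. -/
def largeCylinder (n : ℕ) (w : Fin n → ℕ) (j : ℕ) : Set ℝ :=
  {x | x ∈ Ico (0 : ℝ) 1 ∧ Irrational x ∧ (∀ k : Fin n, cfA x (k + 1) = w k) ∧
    2 ^ j ≤ cfA x (n + 1)}

lemma ediam_largeCylinder_le (n : ℕ) (w : Fin n → ℕ) (j : ℕ) :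
    Metric.ediam (largeCylinder n w j) ≤
      ENNReal.ofReal ((2 ^ j)⁻¹ * ∏ k, ((w k : ℝ) ^ 2)⁻¹) := by
  refine Metric.ediam_le fun x ⟨hx, hxi, hxw, hxj⟩ y ⟨hy, hyi, hyw, hyj⟩ => ?_
  rw [edist_dist, Real.dist_eq]
  refine ENNReal.ofReal_le_ofReal ?_
  have h1 := abs_sub_le_of_cfA_eq hx hxi hy hyi (n := n)
    fun k hk => (hxw ⟨k, hk⟩).trans (hyw ⟨k, hk⟩).symm
  rw [Finset.prod_range] at h1
  simp only [hyw] at h1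
  refine h1.trans (mul_le_mul_of_nonneg_right ?_ (Finset.prod_nonneg fun k _ => by positivity))
  have hsmall : ∀ z ∈ Ico (0 : ℝ) 1, Irrational z → 2 ^ j ≤ cfA z (n + 1) →
      gaussMap^[n] z ≤ (2 ^ j)⁻¹ := fun z hz hzi hzj => by
    refine (iterate_gaussMap_le hz hzi n).trans (inv_anti₀ (by positivity) ?_)
    exact_mod_cast hzj
  rw [abs_le]
  constructor <;> linarith [hsmall x hx hxi hxj, hsmall y hy hyi hyj,
    (iterate_gaussMap_mem hx hxi n).1.1, (iterate_gaussMap_mem hy hyi n).1.1]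

lemma sum_rpow_le {s δ : ℝ} (hδ : 0 < δ) (hτ : 0 ≤ 1 + δ - 2 * s) (A : ℝ) (hA : 0 ≤ A) :
    ∑ a ∈ Finset.Icc 1 ⌊A⌋₊, (((a : ℝ) ^ 2)⁻¹) ^ s ≤
      (∑' a : ℕ, (a : ℝ) ^ (-(1 + δ))) * A ^ (1 + δ - 2 * s) := by
  have hsum : Summable fun a : ℕ => (a : ℝ) ^ (-(1 + δ)) :=
    Real.summable_nat_rpow.2 (by linarith)
  calc ∑ a ∈ Finset.Icc 1 ⌊A⌋₊, (((a : ℝ) ^ 2)⁻¹) ^ s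
      ≤ ∑ a ∈ Finset.Icc 1 ⌊A⌋₊, (a : ℝ) ^ (-(1 + δ)) * A ^ (1 + δ - 2 * s) := by
        refine Finset.sum_le_sum fun a ha => ?_
        obtain ⟨ha1, ha2⟩ := Finset.mem_Icc.1 ha
        have ha0 : (0 : ℝ) < a := by exact_mod_cast ha1
        have haA : (a : ℝ) ≤ A := (Nat.le_floor_iff hA).1 ha2
        have : (((a : ℝ) ^ 2)⁻¹) ^ s = (a : ℝ) ^ (-(1 + δ)) * (a : ℝ) ^ (1 + δ - 2 * s) := by
          rw [← Real.rpow_add ha0, ← Real.rpow_natCast, ← Real.rpow_neg ha0.le,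
            ← Real.rpow_mul ha0.le]
          congr 1
          push_cast
          ring
        rw [this]
        gcongr
    _ = (∑ a ∈ Finset.Icc 1 ⌊A⌋₊, (a : ℝ) ^ (-(1 + δ))) * A ^ (1 + δ - 2 * s) := by
        rw [Finset.sum_mul]
    _ ≤ _ := by
        gcongr
        exact hsum.sum_le_tsum _ fun a _ => by positivity

/-- Words of length `n` whose `k`-th letter is at most `2 ^ ((j + 1) d ^ (k - n))`. -/
noncomputable def boundedWords (d : ℝ) (n j : ℕ) : Finset (Fin n → ℕ) :=
  Fintype.piFinset fun k => Finset.Icc 1 ⌊(2 : ℝ) ^ ((j + 1) * (d ^ (k : ℕ) / d ^ n))⌋₊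

lemma sum_boundedWords_le {d s δ : ℝ} (hd : 1 < d) (hδ : 0 < δ) (hτ : 0 ≤ 1 + δ - 2 * s)
    (n j : ℕ) :
    ∑ w ∈ boundedWords d n j, ((2 ^ j)⁻¹ * ∏ k, ((w k : ℝ) ^ 2)⁻¹) ^ s ≤
      (∑' a : ℕ, (a : ℝ) ^ (-(1 + δ))) ^ n *
        2 ^ ((1 + δ - 2 * s) / (d - 1) * (j + 1) - s * j) := by
  set Z := ∑' a : ℕ, (a : ℝ) ^ (-(1 + δ))
  set τ := 1 + δ - 2 * s with hτ'
  have hZ : 0 ≤ Z := tsum_nonneg fun a => by positivity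
  have hd0 : 0 < d := by linarith
  set A : ℕ → ℝ := fun k => (2 : ℝ) ^ ((j + 1) * (d ^ k / d ^ n))
  have h1 : ∀ w : Fin n → ℕ, ((2 ^ j : ℝ)⁻¹ * ∏ k, ((w k : ℝ) ^ 2)⁻¹) ^ s =
      2 ^ (-(s * j)) * ∏ k, (((w k : ℝ) ^ 2)⁻¹) ^ s := fun w => by
    rw [Real.mul_rpow (by positivity) (Finset.prod_nonneg fun k _ => by positivity),
      ← Real.finsetProd_rpow _ _ fun k _ => by positivity]
    congr 1
    rw [← Real.rpow_natCast, ← Real.rpow_neg (by norm_num), ← Real.rpow_mul (by norm_num)]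
    congr 1
    ring
  have hsum : ∑ k ∈ Finset.range n, d ^ k / d ^ n ≤ (d - 1)⁻¹ := by
    rw [← Finset.sum_div, div_le_iff₀ (by positivity), ← div_eq_inv_mul,
      le_div_iff₀ (by linarith), geom_sum_mul]
    linarith
  simp only [h1]
  rw [← Finset.mul_sum, boundedWords,
    ← Finset.prod_univ_sum (fun k : Fin n => Finset.Icc 1 ⌊A k⌋₊)
      (fun _ a => (((a : ℝ) ^ 2)⁻¹) ^ s)]
  calc (2 : ℝ) ^ (-(s * j)) * ∏ k : Fin n, ∑ a ∈ Finset.Icc 1 ⌊A k⌋₊, (((a : ℝ) ^ 2)⁻¹) ^ s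
      ≤ 2 ^ (-(s * j)) * ∏ k : Fin n, (Z * A k ^ τ) := by
        gcongr with k
        exact sum_rpow_le hδ hτ _ (by positivity)
    _ = 2 ^ (-(s * j)) * (Z ^ n * 2 ^ (τ * (j + 1) * ∑ k ∈ Finset.range n, d ^ k / d ^ n)) := by
        rw [Finset.prod_mul_distrib, Finset.prod_const, Finset.card_univ, Fintype.card_fin,
          Finset.mul_sum, Real.rpow_sum_of_pos (by norm_num),
          Finset.prod_range fun k => (2 : ℝ) ^ (τ * (j + 1) * (d ^ k / d ^ n))]
        congr 2
        refine Finset.prod_congr rfl fun k _ => ?_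
        rw [← Real.rpow_mul (by norm_num)]
        congr 1
        ring
    _ ≤ 2 ^ (-(s * j)) * (Z ^ n * 2 ^ (τ * (j + 1) * (d - 1)⁻¹)) := by
        gcongr
        norm_num
    _ = Z ^ n * 2 ^ (τ / (d - 1) * (j + 1) - s * j) := by
        rw [mul_left_comm, ← Real.rpow_add (by norm_num)]
        congr 2
        ring

lemma summable_pow_mul_rpow_pow {Z ρ d : ℝ} (hZ : 0 ≤ Z) (hρ : 0 < ρ) (hρ1 : ρ < 1)
    (hd : 1 < d) : Summable fun n : ℕ => Z ^ n * ρ ^ (d ^ n) := by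
  rcases hZ.eq_or_lt with rfl | hZ
  · refine summable_of_ne_finset_zero (s := {0}) fun n hn => ?_
    rw [zero_pow (by simpa using hn), zero_mul]
  refine summable_of_ratio_test_tendsto_lt_one zero_lt_one
    (Eventually.of_forall fun n => by positivity) ?_
  have h1 : ∀ n : ℕ, ‖Z ^ (n + 1) * ρ ^ (d ^ (n + 1))‖ / ‖Z ^ n * ρ ^ (d ^ n)‖ =
      Z * ρ ^ ((d - 1) * d ^ n) := fun n => by
    rw [Real.norm_of_nonneg (by positivity), Real.norm_of_nonneg (by positivity),
      div_eq_iff (by positivity)]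
    have : d ^ (n + 1) = (d - 1) * d ^ n + d ^ n := by ring
    rw [this, Real.rpow_add hρ]
    ring
  simp only [h1]
  have h2 : Tendsto (fun n : ℕ => (d - 1) * d ^ n) atTop atTop :=
    (tendsto_pow_atTop_atTop_of_one_lt hd).const_mul_atTop (by linarith)
  have h3 := (tendsto_rpow_atTop_of_base_lt_one ρ (by linarith) hρ1).comp h2
  simpa using h3.const_mul Z

/-- At the record values of `log (a_{n+1}) / d ^ n`, the earlier partial quotients are controlled by
the current one. -/
lemma exists_mem_largeCylinder {b c d x : ℝ} (hd : 1 < d) (hdb : d < b) (hc : 1 < c)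
    (hx : x ∈ Ico (0 : ℝ) 1) (hirr : Irrational x)
    (h : ∃ᶠ k : ℕ in atTop, c ^ b ^ k ≤ cfA x (k + 1)) (N : ℕ) :
    ∃ n ≥ N, ∃ j : ℕ, d ^ n ≤ (j : ℝ) + 1 ∧ ∃ w ∈ boundedWords d n j, x ∈ largeCylinder n w j := by
  classical
  have hd0 : 0 < d := by linarith
  have hone : ∀ k, 1 ≤ cfA x (k + 1) := fun k => (inv_iterate_gaussMap hx hirr k).2
  have hpos : ∀ k, (0 : ℝ) < cfA x (k + 1) := fun k => by exact_mod_cast hone k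
  set u : ℕ → ℝ := fun k => Real.log (cfA x (k + 1)) / d ^ k with hu
  have hulog : ∀ k, Real.log (cfA x (k + 1)) = d ^ k * u k := fun k => by
    rw [hu]; field_simp
  set V := 1 + ∑ k ∈ Finset.range N, |u k|
  have hV1 : 1 ≤ V := le_add_of_nonneg_right (Finset.sum_nonneg fun k _ => abs_nonneg _)
  have hV : ∀ k < N, u k ≤ V := fun k hk => by
    have := Finset.single_le_sum (f := fun k => |u k|) (fun k _ => abs_nonneg _)
      (Finset.mem_range.2 hk)
    linarith [le_abs_self (u k)]
  have hex : ∃ n, V < u n := by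
    have htend : Tendsto (fun k : ℕ => Real.log c * (b / d) ^ k) atTop atTop :=
      (tendsto_pow_atTop_atTop_of_one_lt ((one_lt_div hd0).2 hdb)).const_mul_atTop
        (Real.log_pos hc)
    obtain ⟨k, hk, hVk⟩ := (h.and_eventually (htend.eventually_gt_atTop V)).exists
    refine ⟨k, hVk.trans_le ?_⟩
    have hlog := Real.log_le_log (by positivity) hk
    rw [Real.log_rpow (by linarith)] at hlog
    rw [hu, le_div_iff₀ (by positivity), div_pow]
    refine le_trans (le_of_eq ?_) hlog
    field_simp
  set n := Nat.find hex
  have hn : V < u n := Nat.find_spec hex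
  have hmin : ∀ k < n, u k ≤ V := fun k hk => not_lt.1 (Nat.find_min hex hk)
  have hnN : N ≤ n := by
    by_contra hlt
    exact absurd (hV n (by omega)) (not_le.2 hn)
  set j := Nat.log 2 (cfA x (n + 1))
  have hlog2 : Real.log (cfA x (n + 1)) ≤ (j + 1) * Real.log 2 := by
    rw [← Nat.cast_succ, ← Real.log_pow]
    refine Real.log_le_log (hpos n) ?_
    exact_mod_cast (Nat.lt_pow_succ_log_self one_lt_two _).le
  have hl2 : 0 < Real.log 2 := Real.log_pos one_lt_two
  have hl2' : Real.log 2 ≤ 1 := by linarith [Real.log_two_lt_d9]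
  refine ⟨n, hnN, j, ?_, fun k => cfA x (k + 1), ?_, hx, hirr, fun k => rfl,
    Nat.pow_log_le_self 2 (by have := hone n; omega)⟩
  · calc d ^ n ≤ d ^ n * u n := le_mul_of_one_le_right (by positivity) (by linarith)
      _ ≤ (j + 1) * Real.log 2 := by rw [← hulog]; exact hlog2
      _ ≤ j + 1 := mul_le_of_le_one_right (by positivity) hl2'
  · refine Fintype.mem_piFinset.2 fun k => Finset.mem_Icc.2 ⟨hone k, Nat.le_floor ?_⟩
    rw [← Real.log_le_log_iff (hpos k) (by positivity), Real.log_rpow two_pos, hulog]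
    calc d ^ (k : ℕ) * u k ≤ d ^ (k : ℕ) * u n := by
          gcongr
          exact (hmin k k.2).trans hn.le
      _ = d ^ (k : ℕ) / d ^ n * Real.log (cfA x (n + 1)) := by rw [hulog]; field_simp
      _ ≤ d ^ (k : ℕ) / d ^ n * ((j + 1) * Real.log 2) := by gcongr
      _ = _ := by ring

lemma dimH_le_of_frequently_le {b : ℝ} (hb : 1 < b) :
    dimH {x | x ∈ Ico (0 : ℝ) 1 ∧ Irrational x ∧
      ∃ c : ℝ, 1 < c ∧ ∃ᶠ k : ℕ in atTop, c ^ b ^ k ≤ cfA x (k + 1)} ≤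
      ENNReal.ofReal (1 / (b + 1)) := by
  refine le_of_forall_gt_imp_ge_of_dense fun e he => ?_
  have hhalf : ENNReal.ofReal (1 / (b + 1)) < ENNReal.ofReal (1 / 2) :=
    (ENNReal.ofReal_lt_ofReal_iff (by norm_num)).2
      (one_div_lt_one_div_of_lt (by norm_num) (by linarith))
  obtain ⟨s, hs1, hs2⟩ := ENNReal.lt_iff_exists_nnreal_btwn.1 (lt_min he hhalf)
  refine le_trans ?_ (hs2.trans_le (min_le_left _ _)).le
  have hsb : 1 / (b + 1) < s := (ENNReal.ofReal_lt_iff_lt_toReal (by positivity) (by simp)).1 hs1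
  have hsh : (s : ℝ) < 1 / 2 := by
    simpa using (ENNReal.lt_ofReal_iff_toReal_lt (by simp)).1 (hs2.trans_le (min_le_right _ _))
  clear he hs1 hs2 hhalf
  have hs0 : (0 : ℝ) < s := lt_trans (by positivity) hsb
  obtain ⟨d, hd, hdb⟩ : ∃ d : ℝ, 1 / (s : ℝ) - 1 < d ∧ d < b := by
    refine exists_between ?_
    have := one_div_lt_one_div_of_lt (by positivity) hsb
    rw [one_div_one_div] at this
    linarith
  have hd1 : 1 < d := by
    have := one_div_lt_one_div_of_lt hs0 hsh
    rw [one_div_one_div] at this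
    linarith
  have hsd : 1 < s * (d + 1) := by
    have : 1 / (s : ℝ) < d + 1 := by linarith
    rwa [div_lt_iff₀' hs0] at this
  set δ := (s * (d + 1) - 1) / 2 with hδ
  have hδ0 : 0 < δ := by linarith
  set σ := (1 + δ - 2 * s) / (d - 1) with hσ
  set ε := s - σ with hε
  have hε0 : 0 < ε := by
    rw [hε, sub_pos, hσ, div_lt_iff₀ (by linarith)]
    linarith
  set Z := ∑' a : ℕ, (a : ℝ) ^ (-(1 + δ)) with hZ
  have hZ0 : 0 ≤ Z := tsum_nonneg fun a => by positivity
  set ρ : ℝ := 2 ^ (-(ε / 2)) with hρ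
  have hρ0 : 0 < ρ := by positivity
  have hρ1 : ρ < 1 := Real.rpow_lt_one_of_one_lt_of_neg one_lt_two (by linarith)
  let words : ∀ n : ℕ, ℕ → Finset (Fin n → ℕ) := fun n j =>
    if d ^ n ≤ (j : ℝ) + 1 then boundedWords d n j else ∅
  have hbound : ∀ n j : ℕ,
      ∑ w ∈ words n j, Metric.ediam (largeCylinder n w j) ^ (s : ℝ) ≤
        ENNReal.ofReal (Z ^ n * ρ ^ (d ^ n)) * ENNReal.ofReal (2 ^ (s : ℝ) * ρ ^ (j + 1)) := by
    intro n j
    by_cases hj : d ^ n ≤ (j : ℝ) + 1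
    · simp only [words, if_pos hj]
      calc ∑ w ∈ boundedWords d n j, Metric.ediam (largeCylinder n w j) ^ (s : ℝ)
          ≤ ∑ w ∈ boundedWords d n j,
              ENNReal.ofReal (((2 ^ j)⁻¹ * ∏ k, ((w k : ℝ) ^ 2)⁻¹) ^ (s : ℝ)) := by
            refine Finset.sum_le_sum fun w _ => ?_
            rw [← ENNReal.ofReal_rpow_of_nonneg
              (mul_nonneg (by positivity) (Finset.prod_nonneg fun k _ => by positivity)) hs0.le]
            exact ENNReal.rpow_le_rpow (ediam_largeCylinder_le n w j) hs0.le
        _ = ENNReal.ofReal (∑ w ∈ boundedWords d n j,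
              ((2 ^ j)⁻¹ * ∏ k, ((w k : ℝ) ^ 2)⁻¹) ^ (s : ℝ)) := by
            rw [ENNReal.ofReal_sum_of_nonneg fun w _ => Real.rpow_nonneg
              (mul_nonneg (by positivity) (Finset.prod_nonneg fun k _ => by positivity)) _]
        _ ≤ ENNReal.ofReal ((Z ^ n * ρ ^ (d ^ n)) * (2 ^ (s : ℝ) * ρ ^ (j + 1))) := by
            refine ENNReal.ofReal_le_ofReal
              ((sum_boundedWords_le hd1 hδ0 (by linarith) n j).trans ?_)
            rw [mul_assoc]
            refine mul_le_mul_of_nonneg_left ?_ (by positivity)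
            have h1 : ρ ^ (d ^ n) * (2 ^ (s : ℝ) * ρ ^ (j + 1)) =
                2 ^ (s + -(ε / 2) * d ^ n + -(ε / 2) * (j + 1)) := by
              rw [← Real.rpow_natCast ρ (j + 1), hρ, ← Real.rpow_mul two_pos.le,
                ← Real.rpow_mul two_pos.le, mul_left_comm, ← mul_assoc,
                ← Real.rpow_add two_pos, ← Real.rpow_add two_pos, Nat.cast_succ]
            rw [h1]
            refine Real.rpow_le_rpow_of_exponent_le one_le_two ?_
            have h2 : σ * (j + 1) - s * j = s - ε * (j + 1) := by rw [hε]; ring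
            rw [h2]
            nlinarith
        _ = _ := ENNReal.ofReal_mul (by positivity)
    · simp [words, if_neg hj]
  set D := ∑' j : ℕ, ENNReal.ofReal (2 ^ (s : ℝ) * ρ ^ (j + 1))
  have hD : D ≠ ∞ := by
    refine Summable.tsum_ofReal_ne_top ?_
    exact ((summable_nat_add_iff 1).2 (summable_geometric_of_lt_one hρ0.le hρ1)).mul_left _
  let f : ℕ → ℝ≥0∞ := fun n => ENNReal.ofReal (Z ^ n * ρ ^ (d ^ n)) * D
  have hf : ∑' n, f n ≠ ∞ := by
    rw [ENNReal.tsum_mul_right]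
    exact ENNReal.mul_ne_top
      (summable_pow_mul_rpow_pow hZ0 hρ0 hρ1 hd1).tsum_ofReal_ne_top hD
  refine dimH_le_of_covers (by exact_mod_cast hs0)
    (β := fun N => Σ p : ℕ × ℕ, {w // w ∈ words (p.1 + N) p.2})
    (fun N i => largeCylinder (i.1.1 + N) i.2 i.1.2)
    (ENNReal.tendsto_sum_nat_add f hf) (fun N => ?_) fun N x hx => ?_
  · rw [ENNReal.tsum_sigma', ENNReal.tsum_prod (f := fun n j =>
      ∑' w : {w // w ∈ words (n + N) j}, Metric.ediam (largeCylinder (n + N) w j) ^ (s : ℝ))]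
    refine ENNReal.tsum_le_tsum fun n => ?_
    refine le_trans ?_ ENNReal.tsum_mul_left.le
    refine ENNReal.tsum_le_tsum fun j => ?_
    rw [Finset.tsum_subtype (words (n + N) j)
      fun w => Metric.ediam (largeCylinder (n + N) w j) ^ (s : ℝ)]
    exact hbound (n + N) j
  · obtain ⟨hx, hirr, c, hc, hfreq⟩ := hx
    obtain ⟨n, hn, j, hj, w, hw, hxw⟩ := exists_mem_largeCylinder hd1 hdb hc hx hirr hfreq N
    obtain ⟨m, rfl⟩ := Nat.exists_eq_add_of_le' hn
    refine mem_iUnion.2 ⟨⟨(m, j), w, ?_⟩, hxw⟩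
    simpa only [words, if_pos hj] using hw

lemma dimH_Eprimeℓ_le (ℓ : ℕ) {b c : ℝ} (hb : 1 < b) (hc : 1 < c) :
    dimH (Eprimeℓ ℓ (fun n => c ^ (b ^ n))) ≤ ENNReal.ofReal (1 / (b + 1)) := by
  refine (dimH_mono ?_).trans (dimH_le_of_frequently_le hb)
  rintro x ⟨hx, hirr, hinf⟩
  have hb0 : 0 < b := by linarith
  set e := ((ℓ + 1) * b ^ ℓ)⁻¹ with he
  have he0 : 0 < e := by positivity
  refine ⟨hx, hirr, c ^ e, Real.one_lt_rpow hc he0, frequently_atTop.2 fun N => ?_⟩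
  obtain ⟨n, ⟨hn1, hn⟩, hnN⟩ := hinf.exists_gt N
  by_contra! hlt
  have hle : ∀ i ∈ Finset.range ℓ, (cfA' x (n + i) : ℝ) ≤ c ^ (b ^ n / (ℓ + 1)) := fun i hi => by
    have hi := Finset.mem_range.1 hi
    have h1 := hlt (n + i - 1) (by omega)
    rw [Nat.sub_add_cancel (by omega)] at h1
    have h2 : (cfA' x (n + i) : ℝ) ≤ cfA x (n + i) := by
      rw [cfA']
      split_ifs <;> simp
    refine (h2.trans h1.le).trans ?_
    rw [← Real.rpow_mul (by linarith)]
    refine Real.rpow_le_rpow_of_exponent_le hc.le ?_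
    rw [he, inv_mul_le_iff₀ (by positivity)]
    calc b ^ (n + i - 1) ≤ b ^ (ℓ + n) := pow_le_pow_right₀ hb.le (by omega)
      _ = _ := by rw [pow_add]; field_simp
  have hprod := Finset.prod_le_prod (fun i _ => Nat.cast_nonneg (α := ℝ) (cfA' x (n + i))) hle
  rw [Finset.prod_const, Finset.card_range, ← Real.rpow_natCast, ← Real.rpow_mul (by linarith)]
    at hprod
  have hcontra := (Real.rpow_le_rpow_left_iff hc).1 (hn.trans hprod)
  have : b ^ n / (ℓ + 1) * ℓ < b ^ n := by
    rw [div_mul_eq_mul_div, div_lt_iff₀ (by positivity)]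
    exact mul_lt_mul_of_pos_left (lt_add_one _) (by positivity)
  linarith

lemma Eprimeprimeℓ_subset_Eprimeℓ (ℓ : ℕ) (φ : ℕ → ℝ) : Eprimeprimeℓ ℓ φ ⊆ Eprimeℓ ℓ φ :=
  fun _ ⟨hx, hirr, h⟩ => ⟨hx, hirr, (Ici_infinite 1).mono fun n hn => ⟨hn, h n hn⟩⟩

/-- **Theorem (prime Łuczak theorem).** For every positive integer `ℓ` and reals `b, c > 1`,
with `φ_{b,c}(n) = c^{b^n}`, both `E″_ℓ(φ_{b,c})` and `E′_ℓ(φ_{b,c})` have Hausdorff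
dimension `1/(b+1)`. -/
theorem dimH_Eprimeprimeℓ_eq (ℓ : ℕ) (hℓ : 1 ≤ ℓ) (b c : ℝ) (hb : 1 < b) (hc : 1 < c) :
    dimH (Eprimeprimeℓ ℓ (fun n => c ^ (b ^ n))) = ENNReal.ofReal (1 / (b + 1)) ∧
    dimH (Eprimeℓ ℓ (fun n => c ^ (b ^ n))) = ENNReal.ofReal (1 / (b + 1)) := by
  have hsub := dimH_mono (Eprimeprimeℓ_subset_Eprimeℓ ℓ fun n => c ^ (b ^ n))
  have hlow := le_dimH_Eprimeprimeℓ ℓ hℓ hb hc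
  have hup := dimH_Eprimeℓ_le ℓ hb hc
  exact ⟨le_antisymm (hsub.trans hup) hlow, le_antisymm hup (hlow.trans hsub)⟩
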